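/- arXiv:2210.11623 — 3 statements merged into one kernel-verified Lean document; each statement's English description precedes it below -/
import Mathlib

section
/- Let H be a complex inner product space, D a linear subspace of H, and U, V : D → H linear maps. Suppose there are a real number μ, constants β ∈ [0,1) and c > 0 such that ‖(V − μ·id)ψ‖ ≤ β‖Uψ‖ and ‖ψ‖ ≤ c‖Uψ‖ for all ψ ∈ D. Then for every real λ with |λ − μ| < (1 − β)/c one has ‖(V − λ·id)ψ‖ ≤ (β + c|λ − μ|)‖Uψ‖ for all ψ ∈ D, and consequently ‖Uψ‖² − ‖(V − λ·id)ψ‖² ≥ (1 − (β + c|λ − μ|)²)‖Uψ‖² > 0 for every nonzero ψ ∈ D. -/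
/-- If `‖(V - μ)ψ‖ ≤ β‖Uψ‖` with `β < 1` and `‖ψ‖ ≤ c‖Uψ‖`, then every real `λ` with
`|λ - μ| < (1 - β)/c` satisfies `‖(V - λ)ψ‖ ≤ (β + c|λ - μ|)‖Uψ‖`, and consequently the
Klein-Gordon quadratic form `‖Uψ‖² - ‖(V - λ)ψ‖²` is bounded below by
`(1 - (β + c|λ - μ|)²)‖Uψ‖²`, which is positive for nonzero `ψ`. -/
theorem definiteness_interval_bound
    {H : Type*} [NormedAddCommGroup H] [InnerProductSpace ℂ H]
    (D : Submodule ℂ H) (U V : D →ₗ[ℂ] H) (μ β c : ℝ)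
    (hβ0 : 0 ≤ β) (hβ1 : β < 1) (hc : 0 < c)
    (hV : ∀ ψ : D, ‖V ψ - (μ : ℂ) • (ψ : H)‖ ≤ β * ‖U ψ‖)
    (hU : ∀ ψ : D, ‖(ψ : H)‖ ≤ c * ‖U ψ‖) :
    ∀ lam : ℝ, |lam - μ| < (1 - β) / c →
      (∀ ψ : D, ‖V ψ - (lam : ℂ) • (ψ : H)‖ ≤ (β + c * |lam - μ|) * ‖U ψ‖) ∧
      (∀ ψ : D, ψ ≠ 0 →
        (1 - (β + c * |lam - μ|) ^ 2) * ‖U ψ‖ ^ 2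
            ≤ ‖U ψ‖ ^ 2 - ‖V ψ - (lam : ℂ) • (ψ : H)‖ ^ 2 ∧
        0 < (1 - (β + c * |lam - μ|) ^ 2) * ‖U ψ‖ ^ 2) := by
  intro lam hlam
  have hk0 : 0 ≤ β + c * |lam - μ| := by positivity
  have hk1 : β + c * |lam - μ| < 1 := by
    rw [lt_div_iff₀ hc] at hlam
    linarith
  have bound : ∀ ψ : D, ‖V ψ - (lam : ℂ) • (ψ : H)‖ ≤ (β + c * |lam - μ|) * ‖U ψ‖ := by
    intro ψ
    have split : V ψ - (lam : ℂ) • (ψ : H)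
        = (V ψ - (μ : ℂ) • (ψ : H)) - ((lam - μ : ℝ) : ℂ) • (ψ : H) := by
      push_cast
      module
    calc ‖V ψ - (lam : ℂ) • (ψ : H)‖
        ≤ ‖V ψ - (μ : ℂ) • (ψ : H)‖ + |lam - μ| * ‖(ψ : H)‖ := by
          rw [split]
          refine (norm_sub_le _ _).trans_eq ?_
          rw [norm_smul, Complex.norm_real, Real.norm_eq_abs]
      _ ≤ β * ‖U ψ‖ + |lam - μ| * (c * ‖U ψ‖) := by
          gcongr
          · exact hV ψ
          · exact hU ψ
      _ = (β + c * |lam - μ|) * ‖U ψ‖ := by ring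
  refine ⟨bound, fun ψ hψ => ⟨?_, ?_⟩⟩
  · have hsq := pow_le_pow_left₀ (norm_nonneg _) (bound ψ) 2
    rw [mul_pow] at hsq
    linarith
  · have hψ_pos : 0 < ‖(ψ : H)‖ := norm_pos_iff.mpr (by simpa using hψ)
    have hUψ_pos : 0 < ‖U ψ‖ := pos_of_mul_pos_right (hψ_pos.trans_le (hU ψ)) hc.le
    have hk_sq : (β + c * |lam - μ|) ^ 2 < 1 := pow_lt_one₀ hk0 hk1 two_ne_zero
    exact mul_pos (sub_pos.mpr hk_sq) (pow_pos hUψ_pos 2)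
end

section
/- Let U and V be Hermitian n×n complex matrices with U positive definite, and suppose there is a real number μ such that ‖(V − μI)x‖ < ‖Ux‖ for every nonzero x ∈ ℂⁿ. Then every (complex) eigenvalue of the 2n×2n block matrix K = [[V, I], [U², V]] is real. -/
open Matrix
open scoped ComplexOrder

theorem star_dotProduct_self_eq_sum_norm_sq {ι : Type*} [Fintype ι] (v : ι → ℂ) :
    star v ⬝ᵥ v = ((∑ i, ‖v i‖ ^ 2 : ℝ) : ℂ) := by
  simp [dotProduct, Complex.conj_mul']

theorem Matrix.IsHermitian.star_dotProduct_mul_self_mulVec {ι : Type*} [Fintype ι]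
    {H : Matrix ι ι ℂ} (hH : H.IsHermitian) (x : ι → ℂ) :
    star x ⬝ᵥ ((H * H) *ᵥ x) = ((∑ i, ‖(H *ᵥ x) i‖ ^ 2 : ℝ) : ℂ) := by
  rw [← star_dotProduct_self_eq_sum_norm_sq, star_mulVec, hH.eq, ← mulVec_mulVec,
    dotProduct_mulVec]

/-- A real quadratic with positive leading and negative constant coefficient has only real
roots. -/
theorem Complex.im_eq_zero_of_real_quadratic {p a c : ℝ} (hp : 0 < p) (hc : c < 0) {s : ℂ}
    (hs : (p : ℂ) * s ^ 2 - 2 * a * s + c = 0) : s.im = 0 := by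
  have hre := congrArg Complex.re hs
  have him := congrArg Complex.im hs
  simp [pow_two] at hre him
  by_contra hτ
  have ha : p * s.re = a := by
    apply mul_right_cancel₀ hτ
    linarith
  subst ha
  nlinarith [mul_nonneg hp.le (sq_nonneg s.re), mul_nonneg hp.le (sq_nonneg s.im)]

/-- For Hermitian matrices `U` (positive definite) and `V` such that some real `μ` satisfies
`‖(V - μI)x‖ < ‖Ux‖` (Euclidean norms) for every nonzero `x`, all eigenvalues of the
Klein-Gordon block matrix `K = [[V, I], [U², V]]` are real. -/
theorem kleinGordon_block_matrix_eigenvalues_real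
    {n : ℕ} (U V : Matrix (Fin n) (Fin n) ℂ)
    (hU : U.PosDef) (hV : V.IsHermitian) (μ : ℝ)
    (hdef : ∀ x : Fin n → ℂ, x ≠ 0 →
      ∑ i, ‖((V - (μ : ℂ) • (1 : Matrix (Fin n) (Fin n) ℂ)) *ᵥ x) i‖ ^ 2 <
        ∑ i, ‖(U *ᵥ x) i‖ ^ 2)
    (lam : ℂ)
    (hlam : ∃ z : (Fin n ⊕ Fin n) → ℂ, z ≠ 0 ∧
      (Matrix.fromBlocks V 1 (U * U) V) *ᵥ z = lam • z) :
    lam.im = 0 := by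
  obtain ⟨z, hz, hK⟩ := hlam
  obtain ⟨x, y, rfl⟩ : ∃ x y : Fin n → ℂ, z = Sum.elim x y :=
    ⟨z ∘ Sum.inl, z ∘ Sum.inr, (Sum.elim_comp_inl_inr z).symm⟩
  rw [fromBlocks_mulVec] at hK
  have h₁ : V *ᵥ x + y = lam • x := by
    ext i
    simpa using congrFun hK (Sum.inl i)
  have h₂ : (U * U) *ᵥ x + V *ᵥ y = lam • y := by
    ext i
    simpa using congrFun hK (Sum.inr i)
  have hy : y = lam • x - V *ᵥ x := eq_sub_of_add_eq' h₁
  have hx : x ≠ 0 := by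
    rintro rfl
    apply hz
    ext (i | i) <;> simp [hy]
  set A := V - (μ : ℂ) • (1 : Matrix (Fin n) (Fin n) ℂ) with hA
  have hAH : A.IsHermitian := by
    simp [hA, IsHermitian, hV.eq]
  have hVA : V = A + (μ : ℂ) • 1 := by simp [hA]
  have hquad : (U * U) *ᵥ x =
      (lam - μ) ^ 2 • x - (2 * (lam - μ)) • (A *ᵥ x) + (A * A) *ᵥ x := by
    rw [eq_sub_of_add_eq h₂, hy, hVA, ← mulVec_mulVec]
    simp only [add_mulVec, smul_mulVec, one_mulVec, mulVec_sub, mulVec_add, mulVec_smul]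
    module
  have ha : ((star x ⬝ᵥ (A *ᵥ x)).re : ℂ) = star x ⬝ᵥ (A *ᵥ x) :=
    Complex.ext (by simp) (by simpa using (hAH.im_star_dotProduct_mulVec_self x).symm)
  have hpos : 0 < ∑ i, ‖x i‖ ^ 2 := by
    obtain ⟨i, hi⟩ := Function.ne_iff.mp hx
    exact Finset.sum_pos' (fun _ _ => by positivity)
      ⟨i, Finset.mem_univ i, pow_pos (norm_pos_iff.mpr hi) 2⟩
  have key := Complex.im_eq_zero_of_real_quadratic (a := (star x ⬝ᵥ (A *ᵥ x)).re)
    (s := lam - μ) hpos (sub_neg.mpr (hdef x hx)) (by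
      have := congrArg (star x ⬝ᵥ ·) hquad
      simp only [dotProduct_add, dotProduct_sub, dotProduct_smul, smul_eq_mul,
        hAH.star_dotProduct_mul_self_mulVec, hU.isHermitian.star_dotProduct_mul_self_mulVec,
        star_dotProduct_self_eq_sum_norm_sq] at this
      rw [ha, Complex.ofReal_sub, this]
      ring)
  simpa using key
end

section
/- Let H be a complex Hilbert space and U, V bounded self-adjoint operators on H. Let K be the bounded operator on H × H defined by K(ψ, φ) = (Vψ + φ, U²ψ + Vφ). If λ is a real number such that ‖(V − λI)ψ‖ < ‖Uψ‖ for every nonzero ψ ∈ H, then λ is not an eigenvalue of K. -/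
/-- A self-adjoint operator satisfies `⟪A²x, x⟫ = ‖Ax‖²`. -/
theorem IsSelfAdjoint.inner_apply_apply_self
    {H : Type*} [NormedAddCommGroup H] [InnerProductSpace ℂ H] [CompleteSpace H]
    {A : H →L[ℂ] H} (hA : IsSelfAdjoint A) (x : H) :
    inner ℂ (A (A x)) x = (‖A x‖ : ℂ) ^ 2 :=
  (hA.isSymmetric (A x) x).trans (inner_self_eq_norm_sq_to_K (𝕜 := ℂ) (A x))

/-- Self-adjoint operators whose squares agree at `x` have images of `x` of equal norm. -/
theorem IsSelfAdjoint.norm_apply_eq_of_apply_apply_eq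
    {H : Type*} [NormedAddCommGroup H] [InnerProductSpace ℂ H] [CompleteSpace H]
    {A B : H →L[ℂ] H} (hA : IsSelfAdjoint A) (hB : IsSelfAdjoint B) {x : H}
    (h : A (A x) = B (B x)) : ‖A x‖ = ‖B x‖ := by
  have hsq : (‖A x‖ : ℂ) ^ 2 = (‖B x‖ : ℂ) ^ 2 := by
    rw [← hA.inner_apply_apply_self, ← hB.inner_apply_apply_self, h]
  have hnorm : ‖A x‖ ^ 2 = ‖B x‖ ^ 2 := mod_cast hsq
  exact (sq_eq_sq₀ (norm_nonneg _) (norm_nonneg _)).mp hnorm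

/-- The spectrum of the Klein-Gordon block operator `K(ψ, φ) = (Vψ + φ, U²ψ + Vφ)` avoids the
definiteness interval: if `‖(V - λI)ψ‖ < ‖Uψ‖` for all nonzero `ψ`, then the real number `λ`
is not an eigenvalue of `K`. -/
theorem kleinGordon_no_eigenvalue_in_definiteness_interval
    {H : Type*} [NormedAddCommGroup H] [InnerProductSpace ℂ H] [CompleteSpace H]
    (U V : H →L[ℂ] H) (hU : IsSelfAdjoint U) (hV : IsSelfAdjoint V)
    (K : (H × H) →L[ℂ] (H × H))
    (hK : ∀ ψ φ : H, K (ψ, φ) = (V ψ + φ, U (U ψ) + V φ))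
    (lam : ℝ) (hdef : ∀ ψ : H, ψ ≠ 0 → ‖V ψ - (lam : ℂ) • ψ‖ < ‖U ψ‖) :
    ¬ ∃ p : H × H, p ≠ 0 ∧ K p = (lam : ℂ) • p := by
  rintro ⟨⟨ψ, φ⟩, hp, hKp⟩
  rw [hK, Prod.smul_mk, Prod.mk.injEq] at hKp
  obtain ⟨h₁, h₂⟩ := hKp
  have hφ : φ = (lam : ℂ) • ψ - V ψ := eq_sub_of_add_eq' h₁
  have hψ : ψ ≠ 0 := by
    rintro rfl
    exact hp (by simp [hφ])
  have hW : IsSelfAdjoint (V - (lam : ℂ) • (1 : H →L[ℂ] H)) :=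
    hV.sub (IsSelfAdjoint.smul (Complex.conj_ofReal lam) (IsSelfAdjoint.one _))
  refine (hdef ψ hψ).ne (hW.norm_apply_eq_of_apply_apply_eq hU ?_)
  have hWψ : (V - (lam : ℂ) • (1 : H →L[ℂ] H)) ψ = -φ := by simp [hφ]
  rw [hWψ, eq_sub_of_add_eq h₂]
  simp [sub_eq_add_neg, add_comm]
end
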